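/- Let U ⊆ ℝ^m be an open connected set, h > 0 a real constant, and α : U → (ℝ^m →L[ℝ] ℝ) a smooth closed 1-form (i.e. its derivative is symmetric: Dα(x)(u)(v) = Dα(x)(v)(u) for all x ∈ U, u, v ∈ ℝ^m). Then the following are equivalent: (i) there exists a smooth nowhere-vanishing function b : U → ℂ such that Db(x)(v) = −(2πi/h)·α(x)(v)·b(x) for all x ∈ U and v ∈ ℝ^m; (ii) for every piecewise continuously differentiable loop γ : [0,1] → U with γ(0) = γ(1), the period ∫₀¹ α(γ(t))(γ′(t)) dt lies in h·ℤ. -/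

import Mathlib

open MeasureTheory

namespace BohrSommerfeld

open Set Filter Topology unitInterval

variable {E : Type*} [NormedAddCommGroup E] [NormedSpace ℝ E]

/-- A path in `U` that is `C^1` off a finite set and along which `ω` is integrable. -/
structure Admissible (ω : E → E →L[ℝ] ℝ) (U : Set E) {x y : E} (γ : Path x y) : Prop where
  mem : ∀ t, γ t ∈ U
  integrable : CurveIntegrable ω γ
  contDiffAt : ∃ s : Finset ℝ, ∀ t ∈ Ioo (0 : ℝ) 1, t ∉ s → ContDiffAt ℝ 1 γ.extend t

namespace Admissible

variable {ω : E → E →L[ℝ] ℝ} {U : Set E} {x y z : E}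

theorem symm {γ : Path x y} (hγ : Admissible ω U γ) : Admissible ω U γ.symm where
  mem t := hγ.mem _
  integrable := hγ.integrable.symm
  contDiffAt := by
    classical
    obtain ⟨s, hs⟩ := hγ.contDiffAt
    refine ⟨s.image fun t ↦ 1 - t, fun t ht hts ↦ ?_⟩
    rw [Path.extend_symm]
    refine ContDiffAt.comp (g := γ.extend) (f := fun t : ℝ ↦ 1 - t) t (hs _ ?_ ?_) (by fun_prop)
    · constructor <;> linarith [ht.1, ht.2]
    · exact fun h ↦ hts (Finset.mem_image.2 ⟨1 - t, h, by ring⟩)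

theorem trans {γ : Path x y} {γ' : Path y z} (hγ : Admissible ω U γ) (hγ' : Admissible ω U γ') :
    Admissible ω U (γ.trans γ') where
  mem t := by
    rw [Path.trans_apply]
    split_ifs
    exacts [hγ.mem _, hγ'.mem _]
  integrable := hγ.integrable.trans hγ'.integrable
  contDiffAt := by
    classical
    obtain ⟨s, hs⟩ := hγ.contDiffAt
    obtain ⟨s', hs'⟩ := hγ'.contDiffAt
    refine ⟨insert (1 / 2) (s.image (fun t ↦ t / 2) ∪ s'.image fun t ↦ (t + 1) / 2),
      fun t ht hts ↦ ?_⟩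
    simp only [Finset.mem_insert, Finset.mem_union, Finset.mem_image, not_or, not_exists,
      not_and] at hts
    obtain ⟨h2, h3, h4⟩ := hts
    rcases lt_or_gt_of_ne h2 with h | h
    · have : ContDiffAt ℝ 1 (fun t ↦ γ.extend (2 * t)) t := by
        refine ContDiffAt.comp (g := γ.extend) (f := fun t : ℝ ↦ 2 * t) t (hs _ ?_ ?_)
          (by fun_prop)
        · constructor <;> linarith [ht.1, ht.2]
        · exact fun h ↦ h3 _ h (by ring)
      refine this.congr_of_eventuallyEq ?_
      filter_upwards [Iio_mem_nhds h] with u hu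
      exact Path.extend_trans_of_le_half _ _ (le_of_lt hu)
    · have : ContDiffAt ℝ 1 (fun t ↦ γ'.extend (2 * t - 1)) t := by
        refine ContDiffAt.comp (g := γ'.extend) (f := fun t : ℝ ↦ 2 * t - 1) t (hs' _ ?_ ?_)
          (by fun_prop)
        · constructor <;> linarith [ht.1, ht.2]
        · exact fun h ↦ h4 _ h (by ring)
      refine this.congr_of_eventuallyEq ?_
      filter_upwards [Ioi_mem_nhds h] with u hu
      exact Path.extend_trans_of_half_le _ _ (le_of_lt hu)

theorem segment {B : Set E} (hB : Convex ℝ B) (hBU : B ⊆ U) (hω : ContinuousOn ω U)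
    (hx : x ∈ B) (hy : y ∈ B) : Admissible ω U (Path.segment x y) := by
  have hmem : ∀ t, Path.segment x y t ∈ U := fun t ↦ hBU <| by
    simpa using hB.lineMap_mem hx hy t.2
  have hd : ContDiffOn ℝ 1 (Path.segment x y).extend I :=
    ContDiffOn.congr (f := AffineMap.lineMap x y)
      (by simp only [AffineMap.coe_lineMap, vsub_eq_sub, vadd_eq_add]; fun_prop) (Path.eqOn_extend_segment x y)
  exact ⟨hmem, hω.curveIntegrable_of_contDiffOn hd hmem, ∅, fun t ht _ ↦
    hd.contDiffAt (Icc_mem_nhds ht.1 ht.2)⟩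

end Admissible

/-- Any two points of a connected open set are joined by an admissible path. -/
theorem exists_admissible {ω : E → E →L[ℝ] ℝ} {U : Set E} (hU : IsOpen U)
    (hc : IsPreconnected U) (hω : ContinuousOn ω U) {x y : E} (hx : x ∈ U) (hy : y ∈ U) :
    ∃ γ : Path x y, Admissible ω U γ := by
  refine hc.induction₂ (fun x y ↦ ∃ γ : Path x y, Admissible ω U γ) ?_ ?_ ?_ hx hy
  · intro x hx
    obtain ⟨r, hr, hrU⟩ := Metric.isOpen_iff.1 hU x hx
    filter_upwards [mem_nhdsWithin_of_mem_nhds (Metric.ball_mem_nhds x hr)] with y hy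
    exact ⟨_, .segment (convex_ball x r) hrU hω (Metric.mem_ball_self hr) hy⟩
  · rintro x y z - - - ⟨γ, hγ⟩ ⟨γ', hγ'⟩
    exact ⟨_, hγ.trans hγ'⟩
  · rintro x y - - ⟨γ, hγ⟩
    exact ⟨_, hγ.symm⟩

/-- A nowhere-vanishing solution of `db = c • b • ω` has holonomy `exp (c * ∫ ω)` along curves. -/
theorem eq_mul_exp_integral {ω : E → E →L[ℝ] ℝ} {U : Set E} (hU : IsOpen U)
    (hω : ContinuousOn ω U) {b : E → ℂ} (hb : DifferentiableOn ℝ b U) {c : ℂ}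
    (hdb : ∀ x ∈ U, ∀ v, fderiv ℝ b x v = c * (ω x v : ℂ) * b x)
    {γ γ' : ℝ → E} {s : Set ℝ} (hs : s.Countable) (hsc : IsClosed s)
    (hγ : ContinuousOn γ (Icc 0 1))
    (hγU : ∀ t ∈ Icc (0 : ℝ) 1, γ t ∈ U) (hγ' : ∀ t ∈ Icc (0 : ℝ) 1 \ s, HasDerivAt γ (γ' t) t)
    (hγ'c : ContinuousOn γ' (Icc 0 1 \ s))
    (hi : IntervalIntegrable (fun t ↦ ω (γ t) (γ' t)) volume 0 1) :
    b (γ 1) = b (γ 0) * Complex.exp (c * (∫ t in (0 : ℝ)..1, ω (γ t) (γ' t) : ℝ)) := by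
  set g : ℝ → ℝ := fun t ↦ ω (γ t) (γ' t)
  set G : ℝ → ℝ := fun t ↦ ∫ u in (0 : ℝ)..t, g u
  have hGc : ContinuousOn G (Icc 0 1) := by
    have := intervalIntegral.continuousOn_primitive_interval' hi left_mem_uIcc
    rwa [uIcc_of_le zero_le_one] at this
  have hgc : ContinuousOn g (Icc 0 1 \ s) :=
    (hω.comp (hγ.mono sdiff_subset) fun t ht ↦ hγU t ht.1).clm_apply hγ'c
  have hopen : IsOpen (Ioo (0 : ℝ) 1 \ s) := isOpen_Ioo.sdiff hsc
  have hsub : Ioo (0 : ℝ) 1 \ s ⊆ Icc 0 1 \ s := sdiff_subset_sdiff_left Ioo_subset_Icc_self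
  have hG : ∀ t ∈ Ioo (0 : ℝ) 1 \ s, HasDerivAt G (g t) t := by
    intro t ht
    refine intervalIntegral.integral_hasDerivAt_right
      (hi.mono_set (uIcc_subset_uIcc_left ?_)) ?_ ?_
    · rw [uIcc_of_le zero_le_one]
      exact (hsub ht).1
    · exact (hgc.mono hsub).stronglyMeasurableAtFilter hopen t ht
    · exact (hgc.mono hsub).continuousAt (hopen.mem_nhds ht)
  set f : ℝ → ℂ := fun t ↦ b (γ t) * Complex.exp (-(c * (G t : ℂ)))
  have hf : ∀ t ∈ Ioo (0 : ℝ) 1 \ s, HasDerivAt f 0 t := by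
    intro t ht
    have hU' := hγU t (hsub ht).1
    have h1 : HasDerivAt (fun t ↦ b (γ t)) (c * (g t : ℂ) * b (γ t)) t := by
      have := (hb.differentiableAt (hU.mem_nhds hU')).hasFDerivAt.comp_hasDerivAt t
        (hγ' t (hsub ht))
      rwa [hdb _ hU'] at this
    have h2 := (((hG t ht).ofReal_comp.const_mul c).neg).cexp
    exact (h1.mul h2).congr_deriv (by ring)
  have hfc : ContinuousOn f (Icc 0 1) := by
    have h1 : ContinuousOn (fun t ↦ b (γ t)) (Icc 0 1) := hb.continuousOn.comp hγ hγU
    have h2 : ContinuousOn (fun t ↦ (G t : ℂ)) (Icc 0 1) :=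
      Complex.continuous_ofReal.comp_continuousOn hGc
    exact h1.mul (by fun_prop)
  have key := integral_eq_of_hasDerivAt_off_countable_of_le f (fun _ ↦ 0) zero_le_one hs hfc hf
    (by simp)
  have hG0 : G 0 = 0 := intervalIntegral.integral_same
  simp only [intervalIntegral.integral_zero, f, hG0, Complex.ofReal_zero, mul_zero, neg_zero,
    Complex.exp_zero, mul_one] at key
  rw [← sub_eq_zero.1 key.symm, mul_assoc, ← Complex.exp_add, neg_add_cancel, Complex.exp_zero,
    mul_one]

/-- If `exp (c * ∫ ω) = 1` on every admissible loop, then `db = c • b • ω` has a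
nowhere-vanishing solution. -/
theorem exists_hasFDerivAt_of_loop {ω : E → E →L[ℝ] ℝ} {U : Set E} (hU : IsOpen U)
    (hconn : IsConnected U) (hω : DifferentiableOn ℝ ω U)
    (hclosed : ∀ x ∈ U, ∀ u v, fderiv ℝ ω x u v = fderiv ℝ ω x v u) (c : ℂ)
    (hloop : ∀ (x : E) (γ : Path x x), Admissible ω U γ →
      Complex.exp (c * ((curveIntegral ω γ : ℝ) : ℂ)) = 1) :
    ∃ b : E → ℂ, (∀ x, b x ≠ 0) ∧
      ∀ x ∈ U, HasFDerivAt b (b x • c • Complex.ofRealCLM.comp (ω x)) x := by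
  classical
  obtain ⟨x₀, hx₀⟩ := hconn.nonempty
  have hex (x : E) (hx : x ∈ U) : ∃ γ : Path x₀ x, Admissible ω U γ :=
    exists_admissible hU hconn.isPreconnected hω.continuousOn hx₀ hx
  choose p hp using hex
  let b : E → ℂ := fun x ↦
    if hx : x ∈ U then Complex.exp (c * ((curveIntegral ω (p x hx) : ℝ) : ℂ)) else 1
  have hb (x : E) (γ : Path x₀ x) (hγ : Admissible ω U γ) :
      b x = Complex.exp (c * ((curveIntegral ω γ : ℝ) : ℂ)) := by
    have hx : x ∈ U := by simpa using hγ.mem 1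
    have h := hloop x₀ _ ((hp x hx).trans hγ.symm)
    rw [curveIntegral_trans (hp x hx).integrable hγ.symm.integrable, curveIntegral_symm] at h
    simp only [b, dif_pos hx]
    rw [show c * ((curveIntegral ω (p x hx) : ℝ) : ℂ) = c * ((curveIntegral ω γ : ℝ) : ℂ) +
      c * ((curveIntegral ω (p x hx) + -curveIntegral ω γ : ℝ) : ℂ) by push_cast; ring,
      Complex.exp_add, h, mul_one]
  refine ⟨b, fun x ↦ ?_, fun x hx ↦ ?_⟩
  · simp only [b]
    split_ifs
    exacts [Complex.exp_ne_zero _, one_ne_zero]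
  · obtain ⟨r, hr, hrU⟩ := Metric.isOpen_iff.1 hU x hx
    have hxb := Metric.mem_ball_self (x := x) hr
    have hprim : HasFDerivAt (fun y ↦ curveIntegral ω (Path.segment x y)) (ω x) x := by
      refine ((convex_ball x r).hasFDerivWithinAt_curveIntegral_segment_of_hasFDerivWithinAt_symmetric
        (dω := fderiv ℝ ω) (fun y hy ↦ ?_) (fun y hy u _ v _ ↦ hclosed y (hrU hy) u v)
        hxb hxb).hasFDerivAt (Metric.ball_mem_nhds x hr)
      exact (hω.differentiableAt (hU.mem_nhds (hrU hy))).hasFDerivAt.hasFDerivWithinAt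
    have h1 : HasFDerivAt (fun y ↦ b x * Complex.exp (c * ((curveIntegral ω (.segment x y) : ℝ) : ℂ)))
        (b x • c • Complex.ofRealCLM.comp (ω x)) x := by
      have h := (((Complex.ofRealCLM.hasFDerivAt.comp x hprim).const_mul c).cexp).const_mul (b x)
      simpa using h
    refine h1.congr_of_eventuallyEq ?_
    filter_upwards [Metric.ball_mem_nhds x hr] with y hy
    have hseg : Admissible ω U (.segment x y) :=
      .segment (convex_ball x r) hrU hω.continuousOn hxb hy
    rw [hb y _ ((hp x hx).trans hseg), hb x _ (hp x hx),
      curveIntegral_trans (hp x hx).integrable hseg.integrable, ← Complex.exp_add]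
    push_cast
    ring_nf

/-- Solutions of `db = c • b • ω` with smooth `ω` are smooth. -/
theorem contDiffOn_of_hasFDerivAt {ω : E → E →L[ℝ] ℝ} {U : Set E} (hU : IsOpen U)
    (hω : ContDiffOn ℝ (⊤ : ℕ∞) ω U) {b : E → ℂ} {c : ℂ}
    (hb : ∀ x ∈ U, HasFDerivAt b (b x • c • Complex.ofRealCLM.comp (ω x)) x) :
    ContDiffOn ℝ (⊤ : ℕ∞) b U := by
  have hd : DifferentiableOn ℝ b U := fun x hx ↦ (hb x hx).differentiableAt.differentiableWithinAt
  refine contDiffOn_infty.2 fun n ↦ ?_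
  induction n with
  | zero => exact contDiffOn_zero.2 hd.continuousOn
  | succ n ih =>
    push_cast
    refine (contDiffOn_succ_iff_fderiv_of_isOpen hU).2 ⟨hd, by simp, ?_⟩
    have hωn : ContDiffOn ℝ n ω U := contDiffOn_infty.1 hω n
    refine ContDiffOn.congr ?_ fun x hx ↦ (hb x hx).fderiv
    exact ih.smul (.const_smul c (contDiffOn_const.clm_comp hωn))

end BohrSommerfeld

/-- Bohr–Sommerfeld condition ⟺ existence of a nowhere-vanishing
covariantly constant section, in a trivialization over an open connected set
`U ⊆ ℝ^m` with smooth closed connection 1-form `α`. -/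
theorem bohr_sommerfeld_iff_covariantly_constant_section
    (m : ℕ) (U : Set (Fin m → ℝ)) (hUopen : IsOpen U) (hUconn : IsConnected U)
    (h : ℝ) (hh : 0 < h)
    (α : (Fin m → ℝ) → ((Fin m → ℝ) →L[ℝ] ℝ))
    (hα : ContDiffOn ℝ (⊤ : ℕ∞) α U)
    (hclosed : ∀ x ∈ U, ∀ u v : Fin m → ℝ,
      fderiv ℝ α x u v = fderiv ℝ α x v u) :
    (∃ b : (Fin m → ℝ) → ℂ,
        ContDiffOn ℝ (⊤ : ℕ∞) b U ∧ (∀ x ∈ U, b x ≠ 0) ∧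
        ∀ x ∈ U, ∀ v : Fin m → ℝ,
          fderiv ℝ b x v
            = -(((2 * Real.pi : ℝ) : ℂ) * Complex.I / (h : ℂ)) * ((α x v : ℝ) : ℂ) * b x)
    ↔
    (∀ (γ γ' : ℝ → (Fin m → ℝ)) (s : Finset ℝ),
        ContinuousOn γ (Set.Icc 0 1) →
        (∀ t ∈ Set.Icc (0:ℝ) 1, γ t ∈ U) →
        γ 0 = γ 1 →
        (∀ t ∈ Set.Icc (0:ℝ) 1 \ (s : Set ℝ), HasDerivAt γ (γ' t) t) →
        ContinuousOn γ' (Set.Icc 0 1 \ (s : Set ℝ)) →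
        ∃ n : ℤ, (∫ t in (0:ℝ)..1, α (γ t) (γ' t)) = n * h) := by
  classical
  have hh0 : (h : ℂ) ≠ 0 := by exact_mod_cast hh.ne'
  have hπ : (Real.pi : ℂ) ≠ 0 := by exact_mod_cast Real.pi_ne_zero
  set c : ℂ := -(((2 * Real.pi : ℝ) : ℂ) * Complex.I / (h : ℂ)) with hc
  constructor
  · rintro ⟨b, hb, hb0, hdb⟩ γ γ' s hγ hγU hloop hγ' hγ'c
    by_cases hi : IntervalIntegrable (fun t ↦ α (γ t) (γ' t)) volume 0 1
    · have key := BohrSommerfeld.eq_mul_exp_integral hUopen hα.continuousOn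
        (hb.differentiableOn (by simp)) hdb s.finite_toSet.countable s.finite_toSet.isClosed
        hγ hγU hγ' hγ'c hi
      rw [hloop, eq_comm, mul_eq_left₀ (hb0 _ (hγU 1 (by simp))), Complex.exp_eq_one_iff] at key
      obtain ⟨n, hn⟩ := key
      refine ⟨-n, ?_⟩
      rw [hc] at hn
      have : ((∫ t in (0 : ℝ)..1, α (γ t) (γ' t) : ℝ) : ℂ) = -n * h := by
        have hI := Complex.I_ne_zero
        push_cast at hn
        field_simp at hn
        linear_combination -hn
      exact_mod_cast this
    · exact ⟨0, by simp [intervalIntegral.integral_undef hi]⟩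
  · intro hper
    obtain ⟨b, hb0, hb⟩ := BohrSommerfeld.exists_hasFDerivAt_of_loop hUopen hUconn
      (hα.differentiableOn (by simp)) hclosed c fun x γ hγ ↦ by
        obtain ⟨s, hs⟩ := hγ.contDiffAt
        have hs' : ∀ t ∈ Set.Icc (0 : ℝ) 1 \ (insert 0 (insert 1 s) : Finset ℝ),
            ContDiffAt ℝ 1 γ.extend t := by
          rintro t ⟨ht, hts⟩
          simp only [Finset.coe_insert, Set.mem_insert_iff, Finset.mem_coe, not_or] at hts
          exact hs t ⟨lt_of_le_of_ne ht.1 (Ne.symm hts.1), lt_of_le_of_ne ht.2 hts.2.1⟩ hts.2.2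
        obtain ⟨n, hn⟩ := hper γ.extend (deriv γ.extend) (insert 0 (insert 1 s))
          γ.continuous_extend.continuousOn
          (fun t ht ↦ by rw [γ.extend_apply ht]; exact hγ.mem _)
          (by simp)
          (fun t ht ↦ ((hs' t ht).differentiableAt (by simp)).hasDerivAt)
          (fun t ht ↦ ((hs' t ht).derivWithin (m := 0) (by simp)).continuousAt.continuousWithinAt)
        rw [curveIntegral_eq_intervalIntegral_deriv, hn, Complex.exp_eq_one_iff]
        refine ⟨-n, ?_⟩
        rw [hc]
        push_cast
        field_simp
    refine ⟨b, BohrSommerfeld.contDiffOn_of_hasFDerivAt hUopen hα hb, fun x _ ↦ hb0 x,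
      fun x hx v ↦ ?_⟩
    rw [(hb x hx).fderiv]
    simp
    ring
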